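/- For the cross-entropy loss on features and classifiers with C classes and N/C samples per class, the loss satisfies the bound log(1 + exp(-p_min)) ≤ CELoss(Z, M) ≤ N·log(1 + (C-1)·exp(-p_min)), where p_min = min_{y≠y'} min_i ⟨M_y - M_{y'}, z_{y,i}⟩. -/

import Mathlib

open scoped RealInnerProductSpace

theorem ce_term_eq {C : ℕ} (a : Fin C → ℝ) (y : Fin C) :
    -Real.log (Real.exp (a y) / ∑ y', Real.exp (a y')) =
      Real.log (1 + ∑ y' ∈ Finset.univ.erase y, Real.exp (-(a y - a y'))) := by
  rw [← Real.log_inv, inv_div, ← Finset.add_sum_erase _ _ (Finset.mem_univ y), add_div,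
    div_self (Real.exp_pos _).ne', Finset.sum_div]
  congr 2
  refine Finset.sum_congr rfl fun x _ => ?_
  rw [← Real.exp_sub]
  congr 1
  ring

theorem ce_loss_pmin_bounds (d C n : ℕ) (hC : 2 ≤ C) (hn : 1 ≤ n)
    (M : Fin C → EuclideanSpace ℝ (Fin d))
    (z : Fin C → Fin n → EuclideanSpace ℝ (Fin d))
    (CELoss pmin : ℝ)
    (hCE : CELoss = -∑ y, ∑ i,
      Real.log (Real.exp ⟪M y, z y i⟫ / ∑ y', Real.exp ⟪M y', z y i⟫))
    (hp : pmin = (Finset.univ.offDiag ×ˢ (Finset.univ : Finset (Fin n))).inf'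
      (Finset.Nonempty.product
        ⟨(⟨0, by omega⟩, ⟨1, by omega⟩), by simp [Finset.mem_offDiag, Fin.ext_iff]⟩
        ⟨⟨0, by omega⟩, Finset.mem_univ _⟩)
      (fun q => ⟪M q.1.1 - M q.1.2, z q.1.1 q.2⟫)) :
    Real.log (1 + Real.exp (-pmin)) ≤ CELoss ∧
      CELoss ≤ (C * n : ℝ) * Real.log (1 + ((C : ℝ) - 1) * Real.exp (-pmin)) := by
  have key : CELoss = ∑ y, ∑ i, Real.log (1 + ∑ y' ∈ Finset.univ.erase y,
      Real.exp (-⟪M y - M y', z y i⟫)) := by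
    rw [hCE, ← Finset.sum_neg_distrib]
    refine Finset.sum_congr rfl fun y _ => ?_
    rw [← Finset.sum_neg_distrib]
    refine Finset.sum_congr rfl fun i _ => ?_
    rw [ce_term_eq (fun y' => ⟪M y', z y i⟫) y]
    simp only [inner_sub_left]
  have hle : ∀ y y' i, y ≠ y' → pmin ≤ ⟪M y - M y', z y i⟫ := by
    intro y y' i h
    rw [hp]
    exact Finset.inf'_le (f := fun q : (Fin C × Fin C) × Fin n =>
      (⟪M q.1.1 - M q.1.2, z q.1.1 q.2⟫ : ℝ)) (b := ((y, y'), i))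
      (by simp [Finset.mem_offDiag, h])
  have hex : ∃ y y' i, y ≠ y' ∧ pmin = ⟪M y - M y', z y i⟫ := by
    obtain ⟨q, hq, he⟩ := Finset.exists_mem_eq_inf' (Finset.Nonempty.product
        ⟨(⟨0, by omega⟩, ⟨1, by omega⟩), by simp [Finset.mem_offDiag, Fin.ext_iff]⟩
        ⟨⟨0, by omega⟩, Finset.mem_univ _⟩ :
        (Finset.univ.offDiag ×ˢ (Finset.univ : Finset (Fin n))).Nonempty)
      (fun q : (Fin C × Fin C) × Fin n => (⟪M q.1.1 - M q.1.2, z q.1.1 q.2⟫ : ℝ))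
    refine ⟨q.1.1, q.1.2, q.2, ?_, hp.trans he⟩
    simpa [Finset.mem_offDiag] using hq
  have hS : ∀ y i, 0 ≤ ∑ y' ∈ Finset.univ.erase y, Real.exp (-⟪M y - M y', z y i⟫) :=
    fun y i => Finset.sum_nonneg fun _ _ => (Real.exp_pos _).le
  have hT : ∀ y i, 0 ≤ Real.log (1 + ∑ y' ∈ Finset.univ.erase y,
      Real.exp (-⟪M y - M y', z y i⟫)) :=
    fun y i => Real.log_nonneg (by linarith [hS y i])
  rw [key]
  constructor
  · obtain ⟨y, y', i, hne, he⟩ := hex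
    have h1 : Real.log (1 + Real.exp (-pmin)) ≤ Real.log (1 + ∑ y' ∈ Finset.univ.erase y,
        Real.exp (-⟪M y - M y', z y i⟫)) := by
      apply Real.log_le_log (by positivity)
      rw [he]
      have := Finset.single_le_sum (s := Finset.univ.erase y)
        (f := fun y' => Real.exp (-⟪M y - M y', z y i⟫))
        (fun _ _ => (Real.exp_pos _).le) (Finset.mem_erase.2 ⟨hne.symm, Finset.mem_univ y'⟩)
      linarith
    refine h1.trans ((Finset.single_le_sum (f := fun i => Real.log (1 + ∑ y' ∈ Finset.univ.erase y,
        Real.exp (-⟪M y - M y', z y i⟫))) (fun i _ => hT y i) (Finset.mem_univ i)).trans ?_)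
    exact Finset.single_le_sum (f := fun y => ∑ i, Real.log (1 + ∑ y' ∈ Finset.univ.erase y,
        Real.exp (-⟪M y - M y', z y i⟫)))
        (fun y _ => Finset.sum_nonneg fun i _ => hT y i) (Finset.mem_univ y)
  · have hb : ∀ y i, Real.log (1 + ∑ y' ∈ Finset.univ.erase y,
        Real.exp (-⟪M y - M y', z y i⟫)) ≤
        Real.log (1 + ((C : ℝ) - 1) * Real.exp (-pmin)) := by
      intro y i
      apply Real.log_le_log (by linarith [hS y i])
      have h2 := Finset.sum_le_card_nsmul (Finset.univ.erase y)
        (fun y' => Real.exp (-⟪M y - M y', z y i⟫)) (Real.exp (-pmin)) (by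
          intro x hx
          apply Real.exp_le_exp.2
          linarith [hle y x i (Finset.ne_of_mem_erase hx).symm])
      rw [Finset.card_erase_of_mem (Finset.mem_univ y), Finset.card_univ, Fintype.card_fin,
        nsmul_eq_mul, Nat.cast_sub (by omega), Nat.cast_one] at h2
      linarith
    refine (Finset.sum_le_sum fun y _ => Finset.sum_le_sum fun i _ => hb y i).trans (le_of_eq ?_)
    simp [mul_assoc]
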